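/- Let V be a finite-dimensional real vector space and K a subgroup of GL(V) such that the trace function is bounded on K. Then K is either bounded (has compact closure in GL(V)) or reducible (there exists a proper nonzero K-invariant linear subspace of V). -/

import Mathlib

open Set

open Polynomial in
/-- An endomorphism all of whose positive powers are traceless is nilpotent. -/
theorem nilpotent_of_trace_pow {V : Type*} [AddCommGroup V] [Module ℝ V]
    [FiniteDimensional ℝ V] (a : Module.End ℝ V)
    (h : ∀ k : ℕ, LinearMap.trace ℝ V (a ^ (k + 1)) = 0) : IsNilpotent a := by
  have hp : ∀ p : ℝ[X], LinearMap.trace ℝ V (aeval a (p * X)) = 0 := by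
    intro p
    induction p using Polynomial.induction_on' with
    | add p q hp hq => rw [add_mul, map_add, map_add, hp, hq, add_zero]
    | monomial n r =>
      have : (monomial n r * X : ℝ[X]) = monomial (n + 1) r := by
        rw [monomial_mul_X]
      rw [this, aeval_monomial, ← Algebra.smul_def, map_smul, h, smul_zero]
  have hm : minpoly ℝ a ≠ 0 := minpoly.ne_zero (Algebra.IsIntegral.isIntegral a)
  obtain ⟨q, hq, hnd⟩ := Polynomial.exists_eq_pow_rootMultiplicity_mul_and_not_dvd _ hm 0
  generalize rootMultiplicity 0 (minpoly ℝ a) = k at hq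
  rw [C_0, sub_zero] at hq hnd
  have hcop : IsCoprime (X ^ (k + 1) : ℝ[X]) q :=
    IsCoprime.pow_left ((irreducible_X.coprime_iff_not_dvd).2 hnd)
  obtain ⟨u, w, huw⟩ := hcop
  have h0 : aeval a (X ^ k * q) = 0 := by rw [← hq]; exact minpoly.aeval ℝ a
  set e := aeval a (u * X ^ (k + 1)) with he
  have hidem : IsIdempotentElem e := by
    have h1 : u * X ^ (k + 1) * (u * X ^ (k + 1)) =
        u * X ^ (k + 1) - (u * X * w) * (X ^ k * q) := by
      linear_combination (u * X ^ (k + 1)) * huw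
    rw [IsIdempotentElem, he, ← map_mul, h1, map_sub, map_mul (aeval a) (u * X * w), h0, mul_zero,
      sub_zero]
  have htr : LinearMap.trace ℝ V e = 0 := by
    have := hp (u * X ^ k)
    rwa [mul_assoc, ← pow_succ] at this
  have he0 : e = 0 := (LinearMap.IsIdempotentElem.trace_eq_zero_iff hidem).1 htr
  refine ⟨k, ?_⟩
  have h2 : (X ^ k : ℝ[X]) = X ^ k * (u * X ^ (k + 1)) + w * (X ^ k * q) := by
    linear_combination (-X ^ k) * huw
  have h3 := congrArg (aeval a) h2
  rw [map_add, map_mul, map_mul (aeval a) w, h0, ← he, he0, mul_zero, mul_zero, add_zero,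
    map_pow, aeval_X] at h3
  exact h3

/-- Lemma 3.4 (cruci): let `V` be a (finite-dimensional) real vector space and `K` a
subgroup of `GL(V)` on which the trace function is bounded. Then `K` is either bounded
(its closure is compact) or reducible (there is a proper nonzero `K`-invariant subspace). -/
theorem bounded_trace_bounded_or_reducible
    {V : Type*} [NormedAddCommGroup V] [NormedSpace ℝ V] [FiniteDimensional ℝ V]
    (K : Subgroup (V ≃L[ℝ] V))
    (htr : ∃ c : ℝ, ∀ g ∈ K, |LinearMap.trace ℝ V ((g : V →L[ℝ] V) : V →ₗ[ℝ] V)| ≤ c) :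
    IsCompact (closure ((fun g : V ≃L[ℝ] V => (g : V →L[ℝ] V)) '' (K : Set (V ≃L[ℝ] V)))) ∨
      ∃ W : Submodule ℝ V, W ≠ ⊥ ∧ W ≠ ⊤ ∧ ∀ g ∈ K, ∀ w ∈ W, g w ∈ W := by
  by_cases hred : ∃ W : Submodule ℝ V, W ≠ ⊥ ∧ W ≠ ⊤ ∧ ∀ g ∈ K, ∀ w ∈ W, g w ∈ W
  · exact Or.inr hred
  left
  obtain ⟨c, hc⟩ := htr
  let t : (V →L[ℝ] V) →ₗ[ℝ] ℝ := LinearMap.trace ℝ V ∘ₗ ContinuousLinearMap.coeLM ℝ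
  have ht : ∀ a, t a = LinearMap.trace ℝ V (a : V →ₗ[ℝ] V) := fun _ => rfl
  have tcomm : ∀ a b, t (a * b) = t (b * a) := fun a b =>
    LinearMap.trace_mul_comm ℝ (a : V →ₗ[ℝ] V) (b : V →ₗ[ℝ] V)
  let S : Set (V →L[ℝ] V) := (fun g : V ≃L[ℝ] V => (g : V →L[ℝ] V)) '' (K : Set (V ≃L[ℝ] V))
  have hS1 : (1 : V →L[ℝ] V) ∈ S := ⟨1, K.one_mem, rfl⟩
  have hSm : ∀ a ∈ S, ∀ b ∈ S, a * b ∈ S := by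
    rintro _ ⟨g, hg, rfl⟩ _ ⟨h, hh, rfl⟩
    exact ⟨g * h, K.mul_mem hg hh, rfl⟩
  have hSc : ∀ a ∈ S, |t a| ≤ c := by
    rintro _ ⟨g, hg, rfl⟩
    exact hc g hg
  let A := Submodule.span ℝ S
  have hAr : ∀ a ∈ A, ∀ b ∈ S, a * b ∈ A := by
    intro a ha b hb
    induction ha using Submodule.span_induction with
    | mem x hx => exact Submodule.subset_span (hSm x hx b hb)
    | zero => rw [zero_mul]; exact A.zero_mem
    | add x y _ _ hx hy => rw [add_mul]; exact A.add_mem hx hy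
    | smul r x _ hx => rw [smul_mul_assoc]; exact A.smul_mem r hx
  have hAl : ∀ a ∈ A, ∀ b ∈ S, b * a ∈ A := by
    intro a ha b hb
    induction ha using Submodule.span_induction with
    | mem x hx => exact Submodule.subset_span (hSm b hb x hx)
    | zero => rw [mul_zero]; exact A.zero_mem
    | add x y _ _ hx hy => rw [mul_add]; exact A.add_mem hx hy
    | smul r x _ hx => rw [mul_smul_comm]; exact A.smul_mem r hx
  let I : Submodule ℝ (V →L[ℝ] V) :=
    { carrier := {a | a ∈ A ∧ ∀ h ∈ S, t (a * h) = 0}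
      zero_mem' := ⟨A.zero_mem, fun h _ => by rw [zero_mul, map_zero]⟩
      add_mem' := fun {a b} ha hb => ⟨A.add_mem ha.1 hb.1, fun h hh => by
        rw [add_mul, map_add, ha.2 h hh, hb.2 h hh, add_zero]⟩
      smul_mem' := fun r a ha => ⟨A.smul_mem r ha.1, fun h hh => by
        rw [smul_mul_assoc, map_smul, ha.2 h hh, smul_zero]⟩ }
  have hIr : ∀ a ∈ I, ∀ b ∈ S, a * b ∈ I := fun a ha b hb =>
    ⟨hAr a ha.1 b hb, fun h hh => by rw [mul_assoc]; exact ha.2 _ (hSm b hb h hh)⟩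
  have hIl : ∀ a ∈ I, ∀ b ∈ S, b * a ∈ I := fun a ha b hb =>
    ⟨hAl a ha.1 b hb, fun h hh => by
      rw [mul_assoc, tcomm, mul_assoc]; exact ha.2 _ (hSm h hh b hb)⟩
  have hIA : ∀ a ∈ I, ∀ b ∈ A, a * b ∈ I := by
    intro a ha b hb
    induction hb using Submodule.span_induction with
    | mem x hx => exact hIr a ha x hx
    | zero => rw [mul_zero]; exact I.zero_mem
    | add x y _ _ hx hy => rw [mul_add]; exact I.add_mem hx hy
    | smul r x _ hx => rw [mul_smul_comm]; exact I.smul_mem r hx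
  have hIt : ∀ a ∈ I, t a = 0 := fun a ha => by
    have := ha.2 1 hS1
    rwa [mul_one] at this
  have hIp : ∀ a ∈ I, ∀ k : ℕ, a ^ (k + 1) ∈ I := by
    intro a ha k
    induction k with
    | zero => simpa using ha
    | succ k ih => rw [pow_succ]; exact hIA _ ih a ha.1
  have hcoe : ∀ (a : V →L[ℝ] V) (k : ℕ),
      ((a ^ k : V →L[ℝ] V) : V →ₗ[ℝ] V) = (a : Module.End ℝ V) ^ k := by
    intro a k
    induction k with
    | zero => rfl
    | succ k ih => rw [pow_succ, pow_succ, ← ih]; rfl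
  have hInil : ∀ a ∈ I, IsNilpotent (a : Module.End ℝ V) := by
    intro a ha
    refine nilpotent_of_trace_pow _ fun k => ?_
    rw [← hcoe, ← ht]
    exact hIt _ (hIp a ha k)
  -- irreducibility forces `I = 0`
  have hI0 : ∀ a ∈ I, a = 0 := by
    intro a ha
    ext v
    by_contra hav
    let ev : (V →L[ℝ] V) →ₗ[ℝ] V := LinearMap.applyₗ v ∘ₗ ContinuousLinearMap.coeLM ℝ
    have hev : ∀ b, ev b = b v := fun _ => rfl
    apply hred
    refine ⟨I.map ev, ?_, ?_, ?_⟩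
    · intro hbot
      have : ev a ∈ I.map ev := Submodule.mem_map_of_mem ha
      rw [hbot, Submodule.mem_bot] at this
      exact hav this
    · intro htop
      have : v ∈ I.map ev := htop ▸ Submodule.mem_top
      obtain ⟨b, hb, hbv⟩ := this
      rw [hev] at hbv
      obtain ⟨k, hk⟩ := hInil b hb
      have hkv : ∀ n : ℕ, ((b : Module.End ℝ V) ^ n) v = v := by
        intro n
        induction n with
        | zero => rfl
        | succ n ih => rw [pow_succ, Module.End.mul_apply]; exact (congrArg _ hbv).trans ih
      have hv : v = 0 := by rw [← hkv k, hk]; rfl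
      exact hav (by rw [hv, map_zero, map_zero])
    · rintro g hg _ ⟨b, hb, rfl⟩
      exact ⟨(g : V →L[ℝ] V) * b, hIl b hb _ ⟨g, hg, rfl⟩, rfl⟩
  let T : A →ₗ[ℝ] (S → ℝ) :=
    LinearMap.pi fun h => t ∘ₗ LinearMap.mulRight ℝ (h : V →L[ℝ] V) ∘ₗ A.subtype
  have hT : ∀ a h, T a h = t (a * h) := fun _ _ => rfl
  have hTinj : LinearMap.ker T = ⊥ := by
    rw [LinearMap.ker_eq_bot']
    intro a ha
    apply Subtype.ext
    refine hI0 _ ⟨a.2, fun h hh => ?_⟩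
    rw [← hT a ⟨h, hh⟩, ha]; rfl
  have hemb := LinearMap.isClosedEmbedding_of_injective hTinj
  have hC : IsCompact (Set.univ.pi fun _ : S => Set.Icc (-c) c) :=
    isCompact_univ_pi fun _ => isCompact_Icc
  have hC2 := (hemb.isCompact_preimage hC).image continuous_subtype_val
  refine hC2.closure_of_subset ?_
  intro x hx
  refine ⟨⟨x, Submodule.subset_span hx⟩, ?_, rfl⟩
  intro h _
  exact abs_le.1 (hSc _ (hSm x hx h h.2))
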